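/- The comass-1 form ½ω₊ is SO(8)-conjugate to the convex combination ¼ω₂ + ¼η₁ + ¼η₂ + ¼η₃, and the comass-1 form ½μ is SO(8)-conjugate to the convex combination ¼cay + ¼ω₂ + ¼ω₃ + ¼η₁. -/

import Mathlib

noncomputable section

open scoped BigOperators
open Matrix

/-- `ℝ⁸` with its standard Euclidean structure. -/
abbrev E8 : Type := EuclideanSpace ℝ (Fin 8)

/-- The standard orthonormal basis `e₁, …, e₈` of `ℝ⁸`. -/
def stdB : Fin 8 → E8 := fun i => EuclideanSpace.single i 1

/-- The `j`-th coordinate functional `eʲ`. -/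
def coordL (j : Fin 8) : E8 →ₗ[ℝ] ℝ :=
  (LinearMap.proj j).comp (WithLp.linearEquiv 2 ℝ (Fin 8 → ℝ)).toLinearMap

/-- Alternating 4-forms on `ℝ⁸`. -/
abbrev Form4 : Type := AlternatingMap ℝ E8 ℝ (Fin 4)

/-- The decomposable 4-form `eᵃ∧eᵇ∧eᶜ∧eᵈ` (value `det` of the coordinates). -/
def wedge4 (a b c d : Fin 8) : Form4 :=
  (Matrix.detRowAlternating : AlternatingMap ℝ (Fin 4 → ℝ) ℝ (Fin 4)).compLinearMap
    (LinearMap.pi (fun i : Fin 4 => coordL (![a, b, c, d] i)))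

/-- The comass `‖ω‖` of a 4-form: the sup of values on unit vectors. -/
def comass (ω : Form4) : ℝ :=
  sSup {r : ℝ | ∃ v : Fin 4 → E8, (∀ i, ‖v i‖ = 1) ∧ ω v = r}

open scoped Classical in
/-- The square `|ω|²` of the Euclidean norm of a 4-form:
the sum of the squares of the coefficients over increasing multi-indices. -/
def eNormSq (ω : Form4) : ℝ :=
  ∑ f ∈ Finset.univ.filter (fun f : Fin 4 → Fin 8 => StrictMono f),
    (ω (fun i => stdB (f i))) ^ 2

/-- `e^{1234}` (1-indexed), i.e. `e¹∧e²∧e³∧e⁴` plus its Hodge dual. -/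
def E1234 : Form4 := wedge4 0 1 2 3 + wedge4 4 5 6 7
def E1256 : Form4 := wedge4 0 1 4 5 + wedge4 2 3 6 7
def E1278 : Form4 := wedge4 0 1 6 7 + wedge4 2 3 4 5
def E1357 : Form4 := wedge4 0 2 4 6 + wedge4 1 3 5 7
def E1467 : Form4 := wedge4 0 3 5 6 + wedge4 1 2 4 7
def E1368 : Form4 := wedge4 0 2 5 7 + wedge4 1 3 4 6
def E1458 : Form4 := wedge4 0 3 4 7 + wedge4 1 2 5 6

/-- The Cayley form. -/
def cay : Form4 := E1234 + E1256 + E1278 + E1357 - E1368 - E1458 - E1467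

/-- A 4-form on `ℝ⁸` is self-dual if `ω(e_f) = ω(e_g)` whenever `f`, `g` are complementary
increasing multi-indices whose concatenation is an even permutation of `(1,…,8)`
(i.e. induces the standard orientation). -/
def SelfDual (ω : Form4) : Prop :=
  ∀ (f g : Fin 4 → Fin 8) (σ : Equiv.Perm (Fin 8)),
    StrictMono f → StrictMono g →
    (∀ i : Fin 8, σ i = Fin.append f g (Fin.cast (by norm_num) i)) →
    Equiv.Perm.sign σ = 1 →
    ω (fun i => stdB (f i)) = ω (fun i => stdB (g i))

/-- Membership in `SO(8)`, as real `8 × 8` matrices. -/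
def IsSO8 (g : Matrix (Fin 8) (Fin 8) ℝ) : Prop := g * gᵀ = 1 ∧ g.det = 1

/-- The linear action of an `8 × 8` matrix on `ℝ⁸`. -/
def mulVecL (g : Matrix (Fin 8) (Fin 8) ℝ) : E8 →ₗ[ℝ] E8 :=
  (WithLp.linearEquiv 2 ℝ (Fin 8 → ℝ)).symm.toLinearMap ∘ₗ
    g.mulVecLin ∘ₗ (WithLp.linearEquiv 2 ℝ (Fin 8 → ℝ)).toLinearMap

/-- The action of a matrix `g` on 4-forms: `(g·ω)(v₁,…,v₄) = ω(g⁻¹v₁,…,g⁻¹v₄)`. -/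
def formAct (g : Matrix (Fin 8) (Fin 8) ℝ) (ω : Form4) : Form4 :=
  ω.compLinearMap (mulVecL g⁻¹)

/-- Two 4-forms are `SO(8)`-conjugate if they lie in the same orbit. -/
def SOConj (ω η : Form4) : Prop := ∃ g, IsSO8 g ∧ formAct g ω = η

/-- `ω₂` from Proposition `morecomassone`. -/
def omega2 : Form4 := E1234 + E1256 + E1278 - E1357 + E1467 + E1368 + E1458
def omega3 : Form4 := E1234 - E1256 - E1278 + E1357 + E1467 - E1368 + E1458
def omega4 : Form4 := E1234 - E1256 - E1278 - E1357 - E1467 + E1368 - E1458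
def eta1 : Form4 := E1234 - E1256 + E1278 + E1357 + E1467 + E1368 - E1458
def eta2 : Form4 := E1234 - E1256 + E1278 - E1357 - E1467 - E1368 + E1458
def eta3 : Form4 := E1234 + E1256 - E1278 + E1357 - E1467 + E1368 + E1458
def eta4 : Form4 := E1234 + E1256 - E1278 - E1357 + E1467 - E1368 - E1458

/-- The eight comass-one self-dual forms `ω₁ = cay, ω₂, ω₃, ω₄, η₁, η₂, η₃, η₄`. -/
def forms8 : Fin 8 → Form4 := ![cay, omega2, omega3, omega4, eta1, eta2, eta3, eta4]

/-- The sum of the seven basic self-dual forms with all coefficients `+1`. -/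
def omegaPlus : Form4 := E1234 + E1256 + E1278 + E1357 + E1467 + E1368 + E1458

/-- The form `μ`. -/
def muForm : Form4 := E1234 - E1256 + E1278 + E1357 + E1467 + E1368 + E1458

/-- The matrix `(diag(s) + P_σ) / √2`. For an involution `σ` and signs `s` with `s (σ i) = -s i`
it is a product of commuting reflections, one in each plane `⟨e_i, e_{σ i}⟩`. -/
def pairedReflection (s : Fin 8 → ℝ) (σ : Fin 8 → Fin 8) : Matrix (Fin 8) (Fin 8) ℝ :=
  (√2)⁻¹ • (Matrix.diagonal s + (1 : Matrix (Fin 8) (Fin 8) ℝ).submatrix σ id)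

section Orthogonality

variable {s : Fin 8 → ℝ} {σ : Fin 8 → Fin 8}

lemma diagonal_mul_self_eq_one (hs : ∀ i, s i * s i = 1) :
    Matrix.diagonal s * Matrix.diagonal s = 1 := by
  simp [hs]

lemma one_submatrix_mul_self (hσ : Function.Involutive σ) :
    (1 : Matrix (Fin 8) (Fin 8) ℝ).submatrix σ id * (1 : Matrix (Fin 8) (Fin 8) ℝ).submatrix σ id
      = 1 := by
  ext i j
  simp only [Matrix.mul_apply, Matrix.submatrix_apply, id, Matrix.one_apply, ite_mul, one_mul,
    zero_mul, Finset.sum_ite_eq, Finset.mem_univ, if_true, hσ i]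

lemma one_submatrix_mul_diagonal (hsσ : ∀ i, s (σ i) = -s i) :
    (1 : Matrix (Fin 8) (Fin 8) ℝ).submatrix σ id * Matrix.diagonal s =
      -(Matrix.diagonal s * (1 : Matrix (Fin 8) (Fin 8) ℝ).submatrix σ id) := by
  ext i j
  by_cases h : σ i = j
  · subst h
    simp [Matrix.one_apply, hsσ]
  · simp [h]

lemma pairedReflection_mul_self (hσ : Function.Involutive σ) (hs : ∀ i, s i * s i = 1)
    (hsσ : ∀ i, s (σ i) = -s i) : pairedReflection s σ * pairedReflection s σ = 1 := by
  have h2 : (√2)⁻¹ * (√2)⁻¹ = (1 / 2 : ℝ) := by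
    rw [← mul_inv, Real.mul_self_sqrt (by norm_num)]; norm_num
  rw [pairedReflection, Matrix.smul_mul, Matrix.mul_smul, smul_smul, h2, add_mul, mul_add, mul_add,
    diagonal_mul_self_eq_one hs, one_submatrix_mul_self hσ, one_submatrix_mul_diagonal hsσ]
  module

lemma transpose_pairedReflection (hσ : Function.Involutive σ) :
    (pairedReflection s σ)ᵀ = pairedReflection s σ := by
  ext i j
  have h : σ j = i ↔ σ i = j := hσ.eq_iff.trans eq_comm
  simp [pairedReflection, Matrix.one_apply, Matrix.diagonal_apply, h]
  grind

/-- With `J = diag(s) P_σ` one has `J² = -1`, so `1 + J` is a positive multiple of the square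
`(1 + √2 + J)²`, which forces a nonnegative determinant. -/
lemma det_pairedReflection_nonneg (hσ : Function.Involutive σ) (hs : ∀ i, s i * s i = 1)
    (hsσ : ∀ i, s (σ i) = -s i) (hprod : ∏ i, s i = 1) : 0 ≤ (pairedReflection s σ).det := by
  set D := Matrix.diagonal s with hD
  set P := (1 : Matrix (Fin 8) (Fin 8) ℝ).submatrix σ id with hP
  have hDD : D * D = 1 := diagonal_mul_self_eq_one hs
  have hJ : D * P * (D * P) = -1 := by
    rw [mul_assoc, ← mul_assoc P, one_submatrix_mul_diagonal hsσ, neg_mul, mul_neg, mul_assoc D P P,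
      one_submatrix_mul_self hσ, mul_one, hDD]
  have hsq : √2 * √2 = (2 : ℝ) := Real.mul_self_sqrt (by norm_num)
  have hroot : ((1 + √2) • (1 : Matrix (Fin 8) (Fin 8) ℝ) + D * P) *
      ((1 + √2) • (1 : Matrix (Fin 8) (Fin 8) ℝ) + D * P) = (2 + 2 * √2) • (1 + D * P) := by
    rw [add_mul, mul_add, mul_add, hJ]
    simp only [smul_mul_assoc, mul_smul_comm, one_mul, mul_one, smul_smul]
    have h3 : (1 + √2) * (1 + √2) = 3 + 2 * √2 := by linear_combination hsq
    rw [h3]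
    module
  have hfactor : D + P = D * (1 + D * P) := by
    rw [mul_add, ← mul_assoc, hDD, mul_one, one_mul]
  have hdet := congrArg Matrix.det hroot
  rw [Matrix.det_mul, Matrix.det_smul, Fintype.card_fin] at hdet
  have hnonneg : 0 ≤ (1 + D * P).det :=
    nonneg_of_mul_nonneg_right (hdet ▸ mul_self_nonneg _) (by positivity)
  rw [pairedReflection, Matrix.det_smul, hfactor, Matrix.det_mul, hD, Matrix.det_diagonal, hprod,
    one_mul]
  positivity

lemma isSO8_pairedReflection (hσ : Function.Involutive σ) (hs : ∀ i, s i * s i = 1)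
    (hsσ : ∀ i, s (σ i) = -s i) (hprod : ∏ i, s i = 1) : IsSO8 (pairedReflection s σ) := by
  have hmul := pairedReflection_mul_self hσ hs hsσ
  refine ⟨by rw [transpose_pairedReflection hσ, hmul], ?_⟩
  have hdet := congrArg Matrix.det hmul
  rw [Matrix.det_mul, Matrix.det_one] at hdet
  nlinarith [det_pairedReflection_nonneg hσ hs hsσ hprod]

end Orthogonality

lemma mulVecL_pairedReflection_apply (s : Fin 8 → ℝ) (σ : Fin 8 → Fin 8) (v : E8) (i : Fin 8) :
    mulVecL (pairedReflection s σ) v i = (√2)⁻¹ * (s i * v i + v (σ i)) := by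
  simp [mulVecL, pairedReflection, Matrix.mulVec, dotProduct, Matrix.one_apply,
    Matrix.diagonal_apply, mul_add]

lemma wedge4_apply (a b c d : Fin 8) (v : Fin 4 → E8) :
    wedge4 a b c d v = Matrix.det (Matrix.of fun i j => v i (![a, b, c, d] j)) := rfl

lemma wedge4_pairedReflection (s : Fin 8 → ℝ) (σ : Fin 8 → Fin 8) (a b c d : Fin 8)
    (v : Fin 4 → E8) :
    wedge4 a b c d (fun i => mulVecL (pairedReflection s σ) (v i)) =
      (1 / 4) * Matrix.det (Matrix.of fun i j =>
        s (![a, b, c, d] j) * v i (![a, b, c, d] j) + v i (σ (![a, b, c, d] j))) := by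
  have h : (√2)⁻¹ ^ 4 = (1 / 4 : ℝ) := by
    rw [inv_pow, show (√2 : ℝ) ^ 4 = (√2 ^ 2) ^ 2 by ring, Real.sq_sqrt (by norm_num)]
    norm_num
  have hsmul := Matrix.det_smul (Matrix.of fun i j : Fin 4 =>
    s (![a, b, c, d] j) * v i (![a, b, c, d] j) + v i (σ (![a, b, c, d] j))) (√2)⁻¹
  rw [wedge4_apply, ← h]
  rw [Fintype.card_fin] at hsmul
  rw [← hsmul]
  congr 1
  ext i j
  simp [mulVecL_pairedReflection_apply]

/-- Laplace expansion of a `4 × 4` determinant along its first two rows. -/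
lemma det_fin_four_of (m : Fin 4 → Fin 4 → ℝ) : Matrix.det (Matrix.of m) =
    (m 0 0 * m 1 1 - m 0 1 * m 1 0) * (m 2 2 * m 3 3 - m 2 3 * m 3 2)
    - (m 0 0 * m 1 2 - m 0 2 * m 1 0) * (m 2 1 * m 3 3 - m 2 3 * m 3 1)
    + (m 0 0 * m 1 3 - m 0 3 * m 1 0) * (m 2 1 * m 3 2 - m 2 2 * m 3 1)
    + (m 0 1 * m 1 2 - m 0 2 * m 1 1) * (m 2 0 * m 3 3 - m 2 3 * m 3 0)
    - (m 0 1 * m 1 3 - m 0 3 * m 1 1) * (m 2 0 * m 3 2 - m 2 2 * m 3 0)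
    + (m 0 2 * m 1 3 - m 0 3 * m 1 2) * (m 2 0 * m 3 1 - m 2 1 * m 3 0) := by
  simp [Matrix.det_succ_row_zero, Fin.sum_univ_succ, Fin.succAbove]
  ring

lemma soConj_of_pairedReflection {s : Fin 8 → ℝ} {σ : Fin 8 → Fin 8} {ω η : Form4}
    (hσ : Function.Involutive σ) (hs : ∀ i, s i * s i = 1) (hsσ : ∀ i, s (σ i) = -s i)
    (hprod : ∏ i, s i = 1)
    (h : ∀ v : Fin 4 → E8, ω (fun i => mulVecL (pairedReflection s σ) (v i)) = η v) :
    SOConj ω η := by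
  refine ⟨pairedReflection s σ, isSO8_pairedReflection hσ hs hsσ hprod, ?_⟩
  ext v
  rw [formAct, Matrix.inv_eq_left_inv (pairedReflection_mul_self hσ hs hsσ)]
  exact h v

lemma omegaPlus_pairedReflection (v : Fin 4 → E8) :
    omegaPlus (fun i => mulVecL (pairedReflection ![1, -1, 1, -1, 1, -1, 1, -1]
      ![7, 6, 5, 4, 3, 2, 1, 0]) (v i)) =
      ((2 : ℝ) • E1234 + E1278 + E1368 + E1458 : Form4) v := by
  simp only [omegaPlus, E1234, E1256, E1278, E1357, E1368, E1458, E1467,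
    AlternatingMap.add_apply, AlternatingMap.smul_apply, wedge4_pairedReflection]
  simp only [wedge4_apply, det_fin_four_of, Matrix.cons_val]
  ring

lemma muForm_pairedReflection (v : Fin 4 → E8) :
    muForm (fun i => mulVecL (pairedReflection ![1, -1, 1, -1, -1, 1, -1, 1]
      ![6, 7, 4, 5, 2, 3, 0, 1]) (v i)) =
      ((2 : ℝ) • E1234 + E1278 + E1357 + E1467 : Form4) v := by
  simp only [muForm, E1234, E1256, E1278, E1357, E1368, E1458, E1467, AlternatingMap.add_apply,
    AlternatingMap.sub_apply, AlternatingMap.smul_apply, wedge4_pairedReflection]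
  simp only [wedge4_apply, det_fin_four_of, Matrix.cons_val]
  ring

/-- `½ω₊` is `SO(8)`-conjugate to `¼ω₂ + ¼η₁ + ¼η₂ + ¼η₃` and `½μ` is `SO(8)`-conjugate to
`¼cay + ¼ω₂ + ¼ω₃ + ¼η₁`. -/
theorem half_omegaPlus_half_mu_conj :
    SOConj ((1 / 2 : ℝ) • omegaPlus)
      ((1 / 4 : ℝ) • omega2 + (1 / 4 : ℝ) • eta1 + (1 / 4 : ℝ) • eta2 + (1 / 4 : ℝ) • eta3) ∧
    SOConj ((1 / 2 : ℝ) • muForm)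
      ((1 / 4 : ℝ) • cay + (1 / 4 : ℝ) • omega2 + (1 / 4 : ℝ) • omega3 + (1 / 4 : ℝ) • eta1) := by
  constructor
  · refine soConj_of_pairedReflection (s := ![1, -1, 1, -1, 1, -1, 1, -1])
      (σ := ![7, 6, 5, 4, 3, 2, 1, 0]) (fun i => by fin_cases i <;> rfl)
      (fun i => by fin_cases i <;> simp) (fun i => by fin_cases i <;> simp)
      (by simp [Fin.prod_univ_succ]) fun v => ?_
    rw [AlternatingMap.smul_apply, omegaPlus_pairedReflection, ← AlternatingMap.smul_apply]
    congr 1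
    simp only [omega2, eta1, eta2, eta3]
    module
  · refine soConj_of_pairedReflection (s := ![1, -1, 1, -1, -1, 1, -1, 1])
      (σ := ![6, 7, 4, 5, 2, 3, 0, 1]) (fun i => by fin_cases i <;> rfl)
      (fun i => by fin_cases i <;> simp) (fun i => by fin_cases i <;> simp)
      (by simp [Fin.prod_univ_succ]) fun v => ?_
    rw [AlternatingMap.smul_apply, muForm_pairedReflection, ← AlternatingMap.smul_apply]
    congr 1
    simp only [cay, omega2, omega3, eta1]
    module
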